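/- arXiv:1802.06976 — 2 statements merged into one kernel-verified Lean document; each statement's English description precedes it below -/
import Mathlib

section
/- For every integer n ≥ 2, the set of real numbers α such that ψ_α[A] is positive semidefinite for every n×n real symmetric positive semidefinite matrix A equals {odd positive integers} ∪ [n−2, ∞). -/
open Matrix

/-- Entrywise power with the convention `0 ^ α := 0` for all `α`. -/
noncomputable def powF (α x : ℝ) : ℝ := if x = 0 then 0 else x ^ α

/-- `ψ_α(x) := sgn(x) * |x| ^ α`, with `ψ_α(0) := 0`. -/
noncomputable def psiF (α x : ℝ) : ℝ := if x = 0 then 0 else Real.sign x * |x| ^ α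

/-- `φ_α(x) := |x| ^ α`, with `φ_α(0) := 0`. -/
noncomputable def phiF (α x : ℝ) : ℝ := if x = 0 then 0 else |x| ^ α

theorem psd_iff {n : ℕ} (A : Matrix (Fin n) (Fin n) ℝ) :
    A.PosSemidef ↔ (∀ i j, A i j = A j i) ∧ ∀ x : Fin n → ℝ, 0 ≤ ∑ i, ∑ j, x i * x j * A i j := by
  rw [posSemidef_iff_dotProduct_mulVec]
  have e : ∀ x : Fin n → ℝ, star x ⬝ᵥ (A *ᵥ x) = ∑ i, ∑ j, x i * x j * A i j := by
    intro x
    simp only [dotProduct, mulVec, Finset.mul_sum]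
    refine Finset.sum_congr rfl fun i _ => Finset.sum_congr rfl fun j _ => ?_
    simp; ring
  simp only [e]
  refine and_congr_left fun _ => ?_
  constructor
  · intro h i j
    have := h.apply i j
    simpa using this.symm
  · intro h
    ext i j
    simpa using h j i

theorem psiF_mul (α x y : ℝ) : psiF α (x * y) = psiF α x * psiF α y := by
  unfold psiF
  by_cases hx : x = 0
  · simp [hx]
  by_cases hy : y = 0
  · simp [hy]
  simp only [hx, hy, mul_eq_zero, or_self, if_false, abs_mul]
  rw [Real.mul_rpow (abs_nonneg _) (abs_nonneg _)]
  have : Real.sign (x * y) = Real.sign x * Real.sign y := by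
    rcases lt_or_gt_of_ne hx with h1 | h1 <;> rcases lt_or_gt_of_ne hy with h2 | h2
    · simp [Real.sign_of_neg h1, Real.sign_of_neg h2, Real.sign_of_pos (mul_pos_of_neg_of_neg h1 h2)]
    · simp [Real.sign_of_neg h1, Real.sign_of_pos h2, Real.sign_of_neg (mul_neg_of_neg_of_pos h1 h2)]
    · simp [Real.sign_of_pos h1, Real.sign_of_neg h2, Real.sign_of_neg (mul_neg_of_pos_of_neg h1 h2)]
    · simp [Real.sign_of_pos h1, Real.sign_of_pos h2, Real.sign_of_pos (mul_pos h1 h2)]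
  rw [this]; ring

theorem phiF_mul (α x y : ℝ) : phiF α (x * y) = phiF α x * phiF α y := by
  unfold phiF
  by_cases hx : x = 0
  · simp [hx]
  by_cases hy : y = 0
  · simp [hy]
  simp only [hx, hy, mul_eq_zero, or_self, if_false, abs_mul]
  rw [Real.mul_rpow (abs_nonneg _) (abs_nonneg _)]

theorem psiF_pos (α : ℝ) {x : ℝ} (hx : 0 < x) : psiF α x = x ^ α := by
  simp [psiF, hx.ne', Real.sign_of_pos hx, abs_of_pos hx]

theorem psiF_neg (α : ℝ) {x : ℝ} (hx : x < 0) : psiF α x = - (-x) ^ α := by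
  simp [psiF, hx.ne, Real.sign_of_neg hx, abs_of_neg hx]

theorem phiF_pos (α : ℝ) {x : ℝ} (hx : 0 < x) : phiF α x = x ^ α := by
  simp [phiF, hx.ne', abs_of_pos hx]

theorem phiF_neg (α : ℝ) {x : ℝ} (hx : x < 0) : phiF α x = (-x) ^ α := by
  simp [phiF, hx.ne, abs_of_neg hx]

theorem hasDerivAt_zero_of_abs {f : ℝ → ℝ} {α : ℝ} (hα : 1 < α) (h0 : f 0 = 0)
    (hf : ∀ x, |f x| ≤ |x| ^ α) : HasDerivAt f 0 0 := by
  rw [hasDerivAt_iff_isLittleO]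
  simp only [h0, sub_zero, smul_zero]
  rw [Asymptotics.isLittleO_iff]
  intro c hc
  have hcont : Filter.Tendsto (fun x : ℝ => |x| ^ (α - 1)) (nhds 0) (nhds 0) := by
    have : Continuous (fun x : ℝ => |x| ^ (α - 1)) :=
      continuous_abs.rpow_const (fun _ => Or.inr (by linarith))
    have h := this.tendsto 0
    simpa [Real.zero_rpow (by linarith : α - 1 ≠ 0)] using h
  filter_upwards [hcont.eventually (gt_mem_nhds hc)] with x hx
  by_cases hx0 : x = 0
  · simp [hx0, h0]
  have hp : 0 < |x| := abs_pos.mpr hx0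
  have : |x| ^ α = |x| ^ (α - 1) * |x| := by
    rw [← Real.rpow_add_one hp.ne']; ring_nf
  rw [Real.norm_eq_abs, Real.norm_eq_abs]
  calc |f x| ≤ |x| ^ α := hf x
    _ = |x| ^ (α - 1) * |x| := this
    _ ≤ c * |x| := by gcongr

theorem psiF_deriv {α : ℝ} (hα : 1 < α) (x : ℝ) :
    HasDerivAt (psiF α) (α * phiF (α - 1) x) x := by
  rcases lt_trichotomy x 0 with hx | hx | hx
  · rw [phiF_neg _ hx]
    have h := (((hasDerivAt_id x).neg).rpow_const (p := α) (Or.inr hα.le)).neg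
    refine (h.congr_of_eventuallyEq ?_).congr_deriv ?_
    · filter_upwards [gt_mem_nhds hx] with y hy
      simp [psiF_neg _ hy]
    · simp
  · subst hx
    have : HasDerivAt (psiF α) 0 0 := by
      apply hasDerivAt_zero_of_abs hα (by simp [psiF])
      intro x
      rcases lt_trichotomy x 0 with hx | hx | hx
      · rw [psiF_neg _ hx, abs_neg, abs_of_neg hx, abs_of_nonneg (by have := neg_pos.2 hx; positivity)]
      · simp [hx, psiF]; positivity
      · rw [psiF_pos _ hx, abs_of_pos hx, abs_of_nonneg (by positivity)]
    simpa [phiF] using this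
  · rw [phiF_pos _ hx]
    have h := (((hasDerivAt_id x)).rpow_const (p := α) (Or.inr hα.le))
    refine (h.congr_of_eventuallyEq ?_).congr_deriv ?_
    · filter_upwards [lt_mem_nhds hx] with y hy
      simp [psiF_pos _ hy]
    · simp

theorem phiF_deriv {α : ℝ} (hα : 1 < α) (x : ℝ) :
    HasDerivAt (phiF α) (α * psiF (α - 1) x) x := by
  rcases lt_trichotomy x 0 with hx | hx | hx
  · rw [psiF_neg _ hx]
    have h := (((hasDerivAt_id x).neg).rpow_const (p := α) (Or.inr hα.le))
    refine (h.congr_of_eventuallyEq ?_).congr_deriv ?_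
    · filter_upwards [gt_mem_nhds hx] with y hy
      simp [phiF_neg _ hy]
    · simp
  · subst hx
    have : HasDerivAt (phiF α) 0 0 := by
      apply hasDerivAt_zero_of_abs hα (by simp [phiF])
      intro x
      rcases lt_trichotomy x 0 with hx | hx | hx
      · rw [phiF_neg _ hx, abs_of_neg hx, abs_of_nonneg (by have := neg_pos.2 hx; positivity)]
      · simp [hx, phiF]; positivity
      · rw [phiF_pos _ hx, abs_of_pos hx, abs_of_nonneg (by positivity)]
    simpa [psiF] using this
  · rw [psiF_pos _ hx]
    have h := (((hasDerivAt_id x)).rpow_const (p := α) (Or.inr hα.le))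
    refine (h.congr_of_eventuallyEq ?_).congr_deriv ?_
    · filter_upwards [lt_mem_nhds hx] with y hy
      simp [phiF_pos _ hy]
    · simp

theorem psd_cs {N : ℕ} {A : Matrix (Fin (N+1)) (Fin (N+1)) ℝ} (hA : A.PosSemidef)
    (x : Fin (N+1) → ℝ) :
    (∑ i, x i * A i 0) ^ 2 ≤ (∑ i, ∑ j, x i * x j * A i j) * A 0 0 := by
  rw [psd_iff] at hA
  obtain ⟨hs, hq⟩ := hA
  have key : ∀ t : ℝ, 0 ≤ A 0 0 * (t * t) + (2 * ∑ i, x i * A i 0) * t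
      + ∑ i, ∑ j, x i * x j * A i j := by
    intro t
    have h := hq (fun i => x i + t * (if i = 0 then 1 else 0))
    have e : ∀ i j, (x i + t * (if i = 0 then 1 else 0)) * (x j + t * (if j = 0 then 1 else 0)) * A i j
        = x i * x j * A i j + (if j = 0 then t * (x i * A i j) else 0)
          + (if i = 0 then t * (x j * A i j) else 0)
          + (if i = 0 then (if j = 0 then t * t * A i j else 0) else 0) := by
      intro i j
      split_ifs <;> ring
    have e2 : ∀ j, A 0 j = A j 0 := fun j => hs 0 j
    have e3 : ∑ i : Fin (N+1), ∑ j : Fin (N+1), (if i = 0 then t * (x j * A i j) else 0)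
        = ∑ j, t * (x j * A j 0) := by
      rw [Finset.sum_comm]
      refine Finset.sum_congr rfl fun j _ => ?_
      simp [e2]
    have e4 : ∑ i : Fin (N+1), ∑ j : Fin (N+1),
        (if i = 0 then (if j = 0 then t * t * A i j else 0) else 0) = t * t * A 0 0 := by
      rw [Finset.sum_comm]
      simp
    simp only [e, Finset.sum_add_distrib, e3, e4] at h
    simp only [Finset.sum_ite_eq', Finset.mem_univ, if_true, ← Finset.mul_sum] at h
    linarith
  have := discrim_le_zero key
  unfold discrim at this
  nlinarith

theorem psd_rank1 {N : ℕ} (z : Fin N → ℝ) : (Matrix.of fun i j => z i * z j).PosSemidef := by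
  rw [psd_iff]
  refine ⟨fun i j => by simp [mul_comm], fun x => ?_⟩
  have : ∑ i, ∑ j, x i * x j * (Matrix.of fun i j => z i * z j) i j = (∑ i, x i * z i) ^ 2 := by
    rw [sq, Finset.sum_mul_sum]
    refine Finset.sum_congr rfl fun i _ => Finset.sum_congr rfl fun j _ => ?_
    simp; ring
  rw [this]; positivity

theorem psd_step {N : ℕ} {f f' : ℝ → ℝ} (hmul : ∀ x y, f (x * y) = f x * f y)
    (hd : ∀ x, HasDerivAt f (f' x) x)
    (ih : ∀ B : Matrix (Fin N) (Fin N) ℝ, B.PosSemidef → (B.map f').PosSemidef)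
    (A : Matrix (Fin (N+1)) (Fin (N+1)) ℝ) (hA : A.PosSemidef) : (A.map f).PosSemidef := by
  have hA' := (psd_iff A).1 hA
  obtain ⟨hs, hq⟩ := hA'
  rw [psd_iff]
  refine ⟨fun i j => by simp [hs i j], fun x => ?_⟩
  obtain ⟨z, hz⟩ : ∃ z : Fin (N+1) → ℝ, z = fun i => A i 0 / Real.sqrt (A 0 0) := ⟨_, rfl⟩
  obtain ⟨C, hC⟩ : ∃ C : Matrix (Fin (N+1)) (Fin (N+1)) ℝ, C = A - Matrix.of fun i j => z i * z j :=
    ⟨_, rfl⟩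
  have h00 : 0 ≤ A 0 0 := hA.diag_nonneg
  have hzz : ∀ i j, z i * z j = A i 0 * A j 0 / A 0 0 := by
    intro i j
    rw [hz]; simp only
    rw [div_mul_div_comm, Real.mul_self_sqrt h00]
  have hcol : A 0 0 = 0 → ∀ y : Fin (N+1) → ℝ, ∑ i, y i * A i 0 = 0 := by
    intro h y
    have := psd_cs hA y
    rw [h, mul_zero] at this
    exact pow_eq_zero_iff (two_ne_zero) |>.1 (le_antisymm this (sq_nonneg _))
  have hC0 : ∀ i, C i 0 = 0 := by
    intro i
    simp only [hC, Matrix.sub_apply, Matrix.of_apply, hzz]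
    by_cases h : A 0 0 = 0
    · have := hcol h (fun k => if k = i then 1 else 0)
      simp at this
      simp [this]
    · field_simp; ring
  have hCs : ∀ i j, C i j = C j i := by
    intro i j
    simp only [hC, Matrix.sub_apply, Matrix.of_apply, hs i j, mul_comm (z i)]
  have hCpsd : C.PosSemidef := by
    rw [psd_iff]
    refine ⟨hCs, fun y => ?_⟩
    have e : ∑ i, ∑ j, y i * y j * C i j = ∑ i, ∑ j, y i * y j * A i j
        - (∑ i, y i * A i 0) ^ 2 / A 0 0 := by
      rw [sq, Finset.sum_mul_sum, Finset.sum_div, ← Finset.sum_sub_distrib]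
      refine Finset.sum_congr rfl fun i _ => ?_
      rw [Finset.sum_div, ← Finset.sum_sub_distrib]
      refine Finset.sum_congr rfl fun j _ => ?_
      simp only [hC, Matrix.sub_apply, Matrix.of_apply, hzz]
      ring
    rw [e]
    have := psd_cs hA y
    by_cases h : A 0 0 = 0
    · simp [h, hq y]
    · have hp : 0 < A 0 0 := lt_of_le_of_ne h00 (Ne.symm h)
      rw [sub_nonneg, div_le_iff₀ hp]
      exact this
  obtain ⟨D, hD⟩ : ∃ D : ℝ → Matrix (Fin (N+1)) (Fin (N+1)) ℝ,
    D = fun t => Matrix.of fun i j => z i * z j + t * C i j := ⟨_, rfl⟩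
  have hDpsd : ∀ t : ℝ, 0 ≤ t → (D t).PosSemidef := by
    intro t h0
    have : D t = (Matrix.of fun i j => z i * z j) + t • C := by
      ext i j
      simp [hD]
    rw [this]
    exact (psd_rank1 z).add (hCpsd.smul h0)
  have hder : ∀ t : ℝ, HasDerivAt (fun t => ∑ i, ∑ j, x i * x j * f (D t i j))
      (∑ i, ∑ j, x i * x j * (f' (D t i j) * C i j)) t := by
    intro t
    refine HasDerivAt.fun_sum fun i _ => HasDerivAt.fun_sum fun j _ => ?_
    refine HasDerivAt.const_mul _ ?_
    have h1 : HasDerivAt (fun t => D t i j) (C i j) t := by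
      simp only [hD, Matrix.of_apply]
      simpa using ((hasDerivAt_id t).mul_const (C i j)).const_add (z i * z j)
    exact (hd _).comp t h1
  have hnn : ∀ t : ℝ, 0 ≤ t → 0 ≤ ∑ i, ∑ j, x i * x j * (f' (D t i j) * C i j) := by
    intro t ht
    have hC0' : ∀ j, C 0 j = 0 := fun j => by rw [hCs, hC0]
    have h1 := (ih _ ((hDpsd t ht).submatrix Fin.succ)).hadamard (hCpsd.submatrix Fin.succ)
    have h2 := ((psd_iff _).1 h1).2 (fun i => x i.succ)
    simp only [Fin.sum_univ_succ (n := N), hC0, hC0', mul_zero, Finset.sum_const_zero, zero_add]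
    simpa [Matrix.hadamard_apply] using h2
  have hmono : MonotoneOn (fun t => ∑ i, ∑ j, x i * x j * f (D t i j)) (Set.Icc 0 1) := by
    apply monotoneOn_of_deriv_nonneg (convex_Icc 0 1)
    · exact fun t _ => (hder t).continuousAt.continuousWithinAt
    · exact fun t _ => (hder t).differentiableAt.differentiableWithinAt
    · intro t ht
      rw [interior_Icc] at ht
      rw [(hder t).deriv]
      exact hnn t ht.1.le
  have h01 := hmono (by simp : (0:ℝ) ∈ Set.Icc (0:ℝ) 1) (by simp : (1:ℝ) ∈ Set.Icc (0:ℝ) 1) zero_le_one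
  have hD1 : ∀ i j, D 1 i j = A i j := by intro i j; simp [hD, hC]
  have hD0 : ∀ i j, D 0 i j = z i * z j := by intro i j; simp [hD]
  simp only [hD1, hD0, hmul] at h01
  have h3 := ((psd_iff _).1 (psd_rank1 (fun i => f (z i)))).2 x
  simp only [Matrix.of_apply] at h3
  simpa using h3.trans h01

theorem psd_two {α : ℝ} (hα : 0 ≤ α) {f : ℝ → ℝ} (hmul : ∀ x y, f (x * y) = f x * f y)
    (h0 : f 0 = 0) (hp : ∀ x, 0 < x → f x = x ^ α)
    (A : Matrix (Fin 2) (Fin 2) ℝ) (hA : A.PosSemidef) : (A.map f).PosSemidef := by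
  have hs := ((psd_iff A).1 hA).1
  have hn : ∀ x, 0 ≤ x → 0 ≤ f x := by
    intro x hx
    rcases hx.eq_or_lt with h | h
    · rw [← h, h0]
    · rw [hp x h]; positivity
  have hm : ∀ x y, 0 ≤ x → x ≤ y → f x ≤ f y := by
    intro x y hx hxy
    rcases hx.eq_or_lt with h | h
    · rw [← h, h0]; exact hn y (h ▸ hxy)
    · rw [hp x h, hp y (h.trans_le hxy)]
      exact Real.rpow_le_rpow hx hxy hα
  have hdet : A 1 0 * A 1 0 ≤ A 1 1 * A 0 0 := by
    have := psd_cs hA ![0, 1]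
    simpa [Fin.sum_univ_two, sq] using this
  have h1 := hm _ _ (mul_self_nonneg _) hdet
  rw [hmul, hmul] at h1
  rw [psd_iff]
  refine ⟨fun i j => by simp [hs i j], fun x => ?_⟩
  simp only [Fin.sum_univ_two, Matrix.map_apply]
  have e := hs 0 1
  rw [e]
  have p0 : 0 ≤ f (A 0 0) := hn _ hA.diag_nonneg
  have p1 : 0 ≤ f (A 1 1) := hn _ hA.diag_nonneg
  generalize f (A 0 0) = a at *
  generalize f (A 1 1) = c at *
  generalize f (A 1 0) = b at *
  rcases p0.eq_or_lt with h | h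
  · subst h
    have : b = 0 := by nlinarith
    subst this
    nlinarith [mul_nonneg p1 (mul_self_nonneg (x 1))]
  · have : 0 ≤ a * (x 0 * x 0 * a + x 0 * x 1 * b + (x 1 * x 0 * b + x 1 * x 1 * c)) := by
      nlinarith [sq_nonneg (a * x 0 + b * x 1), mul_nonneg (sub_nonneg.2 h1) (mul_self_nonneg (x 1))]
    exact nonneg_of_mul_nonneg_right this h

theorem suff_strict (m : ℕ) : ∀ α : ℝ, (m : ℝ) < α → ∀ A : Matrix (Fin (m+2)) (Fin (m+2)) ℝ,
    A.PosSemidef → (A.map (psiF α)).PosSemidef ∧ (A.map (phiF α)).PosSemidef := by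
  induction m with
  | zero =>
    intro α hα A hA
    simp only [Nat.cast_zero] at hα
    exact ⟨psd_two hα.le (psiF_mul α) (by simp [psiF]) (fun x hx => psiF_pos α hx) A hA,
      psd_two hα.le (phiF_mul α) (by simp [phiF]) (fun x hx => phiF_pos α hx) A hA⟩
  | succ m ih =>
    intro α hα A hA
    push_cast at hα
    have hm : (0:ℝ) ≤ m := Nat.cast_nonneg m
    have h1 : 1 < α := by linarith
    have hsm : ∀ (g : ℝ → ℝ) (B : Matrix (Fin (m+2)) (Fin (m+2)) ℝ), (B.map g).PosSemidef →
        (B.map (fun x => α * g x)).PosSemidef := by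
      intro g B h
      have := h.smul (by linarith : 0 ≤ α)
      have e : (B.map fun x => α * g x) = α • B.map g := by
        ext i j
        simp
      rw [e]; exact this
    exact ⟨psd_step (psiF_mul α) (psiF_deriv h1)
        (fun B hB => hsm _ B (ih (α - 1) (by linarith) B hB).2) A hA,
      psd_step (phiF_mul α) (phiF_deriv h1)
        (fun B hB => hsm _ B (ih (α - 1) (by linarith) B hB).1) A hA⟩

theorem psiF_continuous (x : ℝ) : Continuous fun α => psiF α x := by
  unfold psiF
  by_cases hx : x = 0
  · simp [hx, continuous_const]
  · simp only [hx, if_false]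
    exact continuous_const.mul (Real.continuous_const_rpow (abs_ne_zero.2 hx))

theorem suff_ge (m : ℕ) (α : ℝ) (hα : (m : ℝ) ≤ α) (A : Matrix (Fin (m+2)) (Fin (m+2)) ℝ)
    (hA : A.PosSemidef) : (A.map (psiF α)).PosSemidef := by
  rw [psd_iff]
  refine ⟨fun i j => by simp [((psd_iff A).1 hA).1 i j], fun x => ?_⟩
  have hc : Continuous fun β : ℝ => ∑ i, ∑ j, x i * x j * psiF β (A i j) :=
    continuous_finsetSum _ fun i _ => continuous_finsetSum _ fun j _ =>
      continuous_const.mul (psiF_continuous _)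
  have ht := (hc.tendsto α).mono_left (nhdsWithin_le_nhds (s := Set.Ioi α))
  simp only [Matrix.map_apply]
  refine ge_of_tendsto ht ?_
  filter_upwards [self_mem_nhdsWithin] with β hβ
  exact ((psd_iff _).1 (suff_strict m β (hα.trans_lt hβ) A hA).1).2 x

theorem suff_odd {n : ℕ} (k : ℕ) (hk : Odd k) (A : Matrix (Fin n) (Fin n) ℝ)
    (hA : A.PosSemidef) : (A.map (psiF k)).PosSemidef := by
  have e : A.map (psiF k) = A.map (fun x => x ^ k) := by
    ext i j
    simp only [Matrix.map_apply]
    rcases lt_trichotomy (A i j) 0 with h | h | h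
    · rw [psiF_neg _ h, Real.rpow_natCast, hk.neg_pow, neg_neg]
    · simp [h, psiF, hk.pos.ne']
    · rw [psiF_pos _ h, Real.rpow_natCast]
  rw [e]
  clear e hk
  induction k with
  | zero =>
    have := psd_rank1 (fun _ : Fin n => (1:ℝ))
    convert this using 1
    ext; simp
  | succ k ih =>
    have := ih.hadamard hA
    have e : (A.map fun x => x ^ (k + 1)) = (A.map fun x => x ^ k) ⊙ A := by
      ext i j
      simp [pow_succ]
    rw [e]; exact this

/-- Signed binomial test vector. -/
noncomputable def xv (N i : ℕ) : ℝ := (-1) ^ (N - i) * (N.choose i : ℝ)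

theorem xv_sum (f : ℝ → ℝ) {N n : ℕ} (h : N < n) :
    ∑ i : Fin n, xv N i * f (i : ℕ) = (fwdDiff 1)^[N] f 0 := by
  rw [fwdDiff_iter_eq_sum_shift, Fin.sum_univ_eq_sum_range (fun i : ℕ => xv N i * f i) n]
  have hsub : Finset.range (N+1) ⊆ Finset.range n := by
    intro i hi; simp at hi ⊢; omega
  rw [← Finset.sum_subset hsub]
  · refine Finset.sum_congr rfl fun i _ => ?_
    simp [xv]
  · intro i _ hi
    simp at hi
    simp [xv, Nat.choose_eq_zero_of_lt (by omega : N < i)]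

theorem xv_poly (P : Polynomial ℝ) {N n : ℕ} (h : N < n) (hP : P.natDegree < N) :
    ∑ i : Fin n, xv N i * P.eval ((i : ℕ) : ℝ) = 0 := by
  rw [xv_sum (fun x => P.eval x) h]
  exact congrFun (Polynomial.fwdDiff_iter_eq_zero_of_degree_lt hP) 0

theorem nec_even {n : ℕ} (k : ℕ) (hk : 2 * k + 2 < n)
    (H : ∀ A : Matrix (Fin n) (Fin n) ℝ, A.PosSemidef →
      (A.map (psiF ((2 * k : ℕ) : ℝ))).PosSemidef) : False := by
  have hk0 : (0:ℝ) ≤ k := Nat.cast_nonneg k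
  obtain ⟨s, hs⟩ : ∃ s : ℝ, s = 1 / ((k + 1) * (k + 1/2)) := ⟨_, rfl⟩
  have hs0 : 0 < s := by rw [hs]; positivity
  have hs1 : s * (k * (k + 1)) < 1 := by
    rw [hs, one_div, inv_mul_lt_iff₀ (by positivity)]; nlinarith
  have hs2 : 1 < s * ((k + 1) * (k + 1)) := by
    rw [hs, one_div, lt_inv_mul_iff₀ (by positivity)]; nlinarith
  obtain ⟨t, ht⟩ : ∃ t : ℕ → ℝ, t = fun i : ℕ => (i : ℝ) - (k + 1) := ⟨_, rfl⟩
  let A : Matrix (Fin n) (Fin n) ℝ := Matrix.of fun i j => 1 + s * (t i * t j)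
  have hA : A.PosSemidef := by
    have h := (psd_rank1 (fun _ : Fin n => (1:ℝ))).add ((psd_rank1 (fun i : Fin n => t i)).smul hs0.le)
    have e : A = (Matrix.of fun i j => (fun _ : Fin n => (1:ℝ)) i * (fun _ : Fin n => (1:ℝ)) j) +
        s • (Matrix.of fun i j => (fun i : Fin n => t i) i * (fun i : Fin n => t i) j) := by
      ext i j
      simp [A]
    rw [e]; exact h
  have hq := ((psd_iff _).1 (H A hA)).2 (fun i => xv (2*k+2) i)
  simp only [Matrix.map_apply, A, Matrix.of_apply] at hq
  have hzero : ∑ i : Fin n, ∑ j : Fin n,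
      xv (2*k+2) i * xv (2*k+2) j * (1 + s * (t i * t j)) ^ (2*k) = 0 := by
    refine Finset.sum_eq_zero fun i _ => ?_
    simp only [mul_assoc]
    rw [← Finset.mul_sum]
    have := xv_poly ((1 + Polynomial.C (s * t i) * (Polynomial.X - Polynomial.C ((k:ℝ) + 1))) ^ (2*k))
      hk (by
        refine lt_of_le_of_lt (b := 2 * k * 1) ?_ (by omega)
        refine Polynomial.natDegree_pow_le_of_le _ ?_
        compute_degree)
    simp only [Polynomial.eval_pow, Polynomial.eval_add, Polynomial.eval_mul, Polynomial.eval_sub,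
      Polynomial.eval_one, Polynomial.eval_C, Polynomial.eval_X] at this
    have e : ∀ j : ℕ, t j = (j:ℝ) - (k + 1) := fun j => by rw [ht]
    simp only [e] at this ⊢
    simp only [mul_assoc] at this
    rw [this, mul_zero]
  have hx0 : xv (2*k+2) 0 = 1 := by
    simp [xv, show 2 * k + 2 = 2 * (k+1) by ring]
  have hxN : xv (2*k+2) (2*k+2) = 1 := by simp [xv]
  have hpos : ∀ a : ℝ, 0 < a → psiF ((2*k : ℕ) : ℝ) a = a ^ (2*k) := fun a ha => by
    rw [psiF_pos _ ha, Real.rpow_natCast]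
  have hneg : ∀ a : ℝ, a < 0 → psiF ((2*k : ℕ) : ℝ) a < 0 := fun a ha => by
    rw [psiF_neg _ ha]
    have := neg_pos.2 ha
    have : 0 < (-a) ^ (((2*k : ℕ) : ℝ)) := by positivity
    linarith
  have hpn : ∀ a : ℝ, 0 ≤ a ^ (2*k) := fun a => by rw [pow_mul]; positivity
  have ht0 : t 0 = -(k+1) := by simp [ht]
  have htN : t (2*k+2) = k+1 := by simp [ht]; ring
  have h0N : 1 + s * (t 0 * t (2*k+2)) < 0 := by rw [ht0, htN]; nlinarith
  have hterm0 : xv (2*k+2) 0 * xv (2*k+2) (2*k+2) * psiF ((2*k : ℕ) : ℝ) (1 + s * (t 0 * t (2*k+2)))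
      < xv (2*k+2) 0 * xv (2*k+2) (2*k+2) * (1 + s * (t 0 * t (2*k+2))) ^ (2*k) := by
    rw [hx0, hxN, one_mul, one_mul, one_mul]
    exact (hneg _ h0N).trans_le (hpn _)
  have hbig : ∀ i j : ℕ, i ≤ 2*k+2 → j ≤ 2*k+2 → ¬ (i = 0 ∧ j = 2*k+2) → ¬ (i = 2*k+2 ∧ j = 0) →
      0 < 1 + s * (t i * t j) := by
    intro i j hi hj h1 h2
    have hb : ∀ i : ℕ, i ≤ 2*k+2 → -((k:ℝ)+1) ≤ t i ∧ t i ≤ k + 1 := by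
      intro i hi
      have : (i:ℝ) ≤ 2*k+2 := by exact_mod_cast hi
      have : (0:ℝ) ≤ i := Nat.cast_nonneg i
      rw [ht]; constructor <;> simp only <;> linarith
    have hb1 : ∀ i : ℕ, i ≠ 0 → -(k:ℝ) ≤ t i := by
      intro i hi
      have : (1:ℝ) ≤ i := by exact_mod_cast Nat.one_le_iff_ne_zero.2 hi
      rw [ht]; simp only; linarith
    have hb2 : ∀ i : ℕ, i ≤ 2*k+2 → i ≠ 2*k+2 → t i ≤ k := by
      intro i hi hi'
      have : (i:ℝ) ≤ 2*k+1 := by exact_mod_cast (by omega : i ≤ 2*k+1)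
      rw [ht]; simp only; linarith
    obtain ⟨a1, a2⟩ := hb i hi
    obtain ⟨b1, b2⟩ := hb j hj
    have key : -(k * (k+1) : ℝ) ≤ t i * t j := by
      rcases le_total 0 (t i) with c | c <;> rcases le_total 0 (t j) with d | d
      · nlinarith [mul_nonneg c d]
      · by_cases e : j = 0
        · have e2 := hb2 i hi (fun h => h2 ⟨h, e⟩)
          nlinarith
        · have := hb1 j e
          nlinarith
      · by_cases e : i = 0
        · have e2 := hb2 j hj (fun h => h1 ⟨e, h⟩)
          nlinarith
        · have := hb1 i e
          nlinarith
      · nlinarith [mul_nonneg_of_nonpos_of_nonpos c d]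
    nlinarith
  have hterm : ∀ i j : ℕ, xv (2*k+2) i * xv (2*k+2) j * psiF ((2*k : ℕ) : ℝ) (1 + s * (t i * t j))
      ≤ xv (2*k+2) i * xv (2*k+2) j * (1 + s * (t i * t j)) ^ (2*k) := by
    intro i j
    by_cases hi : i ≤ 2*k+2
    swap
    · simp [xv, Nat.choose_eq_zero_of_lt (not_le.1 hi)]
    by_cases hj : j ≤ 2*k+2
    swap
    · simp [xv, Nat.choose_eq_zero_of_lt (not_le.1 hj)]
    by_cases h1 : i = 0 ∧ j = 2*k+2
    · rw [h1.1, h1.2]; exact hterm0.le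
    by_cases h2 : i = 2*k+2 ∧ j = 0
    · rw [h2.1, h2.2, mul_comm (xv _ _) (xv _ 0), mul_comm (t _) (t 0)]; exact hterm0.le
    rw [hpos _ (hbig i j hi hj h1 h2)]
  have hlt : ∑ i : Fin n, ∑ j : Fin n,
      xv (2*k+2) i * xv (2*k+2) j * psiF ((2*k : ℕ) : ℝ) (1 + s * (t i * t j)) <
      ∑ i : Fin n, ∑ j : Fin n,
      xv (2*k+2) i * xv (2*k+2) j * (1 + s * (t i * t j)) ^ (2*k) := by
    refine Finset.sum_lt_sum (fun i _ => Finset.sum_le_sum fun j _ => hterm i j)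
      ⟨⟨0, by omega⟩, Finset.mem_univ _, ?_⟩
    exact Finset.sum_lt_sum (fun j _ => hterm _ j) ⟨⟨2*k+2, hk⟩, Finset.mem_univ _, hterm0⟩
  rw [hzero] at hlt
  exact absurd hq (not_le.2 hlt)

theorem neg_of_deriv_neg {g g' : ℝ → ℝ} {δ : ℝ} (h0 : g 0 = 0)
    (hd : ∀ e, 0 ≤ e → HasDerivAt g (g' e) e) (hn : ∀ e, 0 < e → e < δ → g' e < 0) :
    ∀ e, 0 < e → e < δ → g e < 0 := by
  intro e he heδ
  have hanti : StrictAntiOn g (Set.Icc 0 e) := by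
    apply strictAntiOn_of_deriv_neg (convex_Icc 0 e)
    · exact fun t ht => (hd t ht.1).continuousAt.continuousWithinAt
    · intro t ht
      rw [interior_Icc] at ht
      rw [(hd t ht.1.le).deriv]
      exact hn t ht.1 (ht.2.trans heδ)
  have := hanti (Set.left_mem_Icc.2 he.le) (Set.right_mem_Icc.2 he.le) he
  rwa [h0] at this

theorem nec_frac {n : ℕ} (α : ℝ) (N : ℕ) (hN : N < n)
    (hc : ∏ r ∈ Finset.range N, (α - r) < 0)
    (H : ∀ A : Matrix (Fin n) (Fin n) ℝ, A.PosSemidef → (A.map (psiF α)).PosSemidef) : False := by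
  let g : ℕ → ℝ → ℝ := fun l e => (∏ r ∈ Finset.range l, (α - r)) *
    ∑ i : Fin n, ∑ j : Fin n, xv N i * xv N j *
      ((((i:ℕ):ℝ) * ((j:ℕ):ℝ)) ^ l * (1 + e * (((i:ℕ):ℝ) * ((j:ℕ):ℝ))) ^ (α - l))
  have hg0 : ∀ l, g l 0 = (∏ r ∈ Finset.range l, (α - r)) * (∑ i : Fin n, xv N i * ((i:ℕ):ℝ) ^ l) ^ 2 := by
    intro l
    simp only [g]
    congr 1
    rw [sq, Finset.sum_mul_sum]
    refine Finset.sum_congr rfl fun i _ => Finset.sum_congr rfl fun j _ => ?_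
    simp [mul_pow]; ring
  have hgd : ∀ l e, 0 ≤ e → HasDerivAt (g l) (g (l+1) e) e := by
    intro l e he
    have e1 : g (l+1) e = (∏ r ∈ Finset.range l, (α - r)) *
      ∑ i : Fin n, ∑ j : Fin n, xv N i * xv N j *
      ((((i:ℕ):ℝ) * ((j:ℕ):ℝ)) ^ l * ((((i:ℕ):ℝ) * ((j:ℕ):ℝ)) * (α - l) *
        (1 + e * (((i:ℕ):ℝ) * ((j:ℕ):ℝ))) ^ (α - l - 1))) := by
      simp only [g]
      rw [Finset.prod_range_succ, mul_assoc]
      congr 1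
      simp only [Finset.mul_sum]
      refine Finset.sum_congr rfl fun i _ => Finset.sum_congr rfl fun j _ => ?_
      have : α - ((l+1 : ℕ) : ℝ) = α - l - 1 := by push_cast; ring
      rw [this]; ring
    rw [e1]
    refine HasDerivAt.const_mul _ ?_
    refine HasDerivAt.fun_sum fun i _ => HasDerivAt.fun_sum fun j _ => ?_
    refine HasDerivAt.const_mul _ (HasDerivAt.const_mul _ ?_)
    have hb : HasDerivAt (fun e : ℝ => 1 + e * (((i:ℕ):ℝ) * ((j:ℕ):ℝ))) (((i:ℕ):ℝ) * ((j:ℕ):ℝ)) e := by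
      simpa using ((hasDerivAt_id e).mul_const (((i:ℕ):ℝ) * ((j:ℕ):ℝ))).const_add 1
    exact hb.rpow_const (Or.inl (by positivity))
  have hzero : ∀ l, l < N → g l 0 = 0 := by
    intro l hl
    rw [hg0]
    have := xv_poly (Polynomial.X ^ l) hN (by simpa using hl)
    simp only [Polynomial.eval_pow, Polynomial.eval_X] at this
    rw [this]; simp
  have hneg : g N 0 < 0 := by
    rw [hg0, xv_sum (fun x => x ^ N) hN, fwdDiff_iter_eq_factorial]
    refine mul_neg_of_neg_of_pos hc ?_
    have : (0:ℝ) < (N.factorial : ℝ) := by exact_mod_cast N.factorial_pos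
    simp only [Pi.natCast_apply]
    positivity
  obtain ⟨δ, hδ, hδ'⟩ : ∃ δ > 0, ∀ e, 0 < e → e < δ → g N e < 0 := by
    have := (hgd N 0 le_rfl).continuousAt.eventually (gt_mem_nhds hneg)
    obtain ⟨δ, hδ, h⟩ := Metric.eventually_nhds_iff.1 this
    refine ⟨δ, hδ, fun e h1 h2 => h ?_⟩
    simpa [abs_of_pos h1] using h2
  have hall : ∀ m, m ≤ N → ∀ e, 0 < e → e < δ → g (N - m) e < 0 := by
    intro m
    induction m with
    | zero => intro _; simpa using hδ'
    | succ m ih =>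
      intro hm
      have h1 := ih (by omega)
      have e1 : N - m = (N - (m+1)) + 1 := by omega
      rw [e1] at h1
      exact neg_of_deriv_neg (hzero _ (by omega)) (hgd _) h1
  have hfin := hall N le_rfl (δ/2) (by positivity) (by linarith)
  let A : Matrix (Fin n) (Fin n) ℝ := Matrix.of fun i j => 1 + (δ/2) * (((i:ℕ):ℝ) * ((j:ℕ):ℝ))
  have hA : A.PosSemidef := by
    have h := (psd_rank1 (fun _ : Fin n => (1:ℝ))).add
      ((psd_rank1 (fun i : Fin n => ((i:ℕ):ℝ))).smul (by positivity : 0 ≤ δ/2))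
    have e : A = (Matrix.of fun i j => (fun _ : Fin n => (1:ℝ)) i * (fun _ : Fin n => (1:ℝ)) j) +
        (δ/2) • (Matrix.of fun i j => (fun i : Fin n => ((i:ℕ):ℝ)) i * (fun i : Fin n => ((i:ℕ):ℝ)) j) := by
      ext i j
      simp [A]
    rw [e]; exact h
  have hq := ((psd_iff _).1 (H A hA)).2 (fun i => xv N i)
  simp only [Matrix.map_apply, A, Matrix.of_apply] at hq
  refine absurd hq (not_le.2 ?_)
  rw [Nat.sub_self] at hfin
  refine lt_of_eq_of_lt ?_ hfin
  simp only [g, Finset.range_zero, Finset.prod_empty, one_mul, pow_zero, Nat.cast_zero,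
    sub_zero]
  refine Finset.sum_congr rfl fun i _ => Finset.sum_congr rfl fun j _ => ?_
  rw [psiF_pos _ (by positivity)]


/-- `H_{K_n}^ψ = {odd positive integers} ∪ [n - 2, ∞)`. -/
theorem stmt3 (n : ℕ) (hn : 2 ≤ n) :
    {α : ℝ | ∀ A : Matrix (Fin n) (Fin n) ℝ, A.PosSemidef → (A.map (psiF α)).PosSemidef}
      = {α : ℝ | ∃ k : ℕ, Odd k ∧ α = k} ∪ Set.Ici ((n : ℝ) - 2) := by
  ext α
  simp only [Set.mem_ofPred_eq, Set.mem_union, Set.mem_Ici]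
  constructor
  · intro H
    by_contra hcon
    rw [not_or, not_le] at hcon
    obtain ⟨h1, h2⟩ := hcon
    by_cases hnat : ∃ m : ℕ, α = m
    · obtain ⟨m, rfl⟩ := hnat
      rcases Nat.even_or_odd m with he | ho
      · obtain ⟨k, hk⟩ := he.exists_two_nsmul
        simp only [smul_eq_mul] at hk
        subst hk
        refine nec_even k ?_ H
        have : ((2 * k : ℕ) : ℝ) + 2 < n := by linarith
        exact_mod_cast this
      · exact h1 ⟨m, ho, rfl⟩
    · rcases lt_or_ge α 0 with hneg | hpos
      · exact nec_frac α 1 (by omega) (by simpa using hneg) H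
      · have hfl : ((⌊α⌋₊ : ℕ) : ℝ) < α :=
          lt_of_le_of_ne (Nat.floor_le hpos) (fun h => hnat ⟨_, h.symm⟩)
        refine nec_frac α (⌊α⌋₊ + 2) ?_ ?_ H
        · have : ((⌊α⌋₊ + 2 : ℕ) : ℝ) < n := by push_cast; linarith
          exact_mod_cast this
        · rw [Finset.prod_range_succ]
          refine mul_neg_of_pos_of_neg (Finset.prod_pos fun r hr => ?_) ?_
          · have hr' : r ≤ ⌊α⌋₊ := by simp at hr; omega
            have : (r : ℝ) ≤ (⌊α⌋₊ : ℕ) := by exact_mod_cast hr'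
            linarith
          · have := Nat.lt_floor_add_one α
            push_cast; linarith
  · rintro (⟨k, hk, rfl⟩ | h)
    · exact fun A hA => suff_odd k hk A hA
    · obtain ⟨m, rfl⟩ := Nat.exists_eq_add_of_le' hn
      refine fun A hA => suff_ge m α ?_ A hA
      push_cast at h
      linarith
end

section
/- Let G = (V,E) be a finite simple graph on V = {1,…,n} admitting a decomposition (A,C,B), let α ∈ ℝ, and let f = ψ_α or f = φ_α. Suppose f[M] ∈ P_G(ℝ) for every M ∈ P_G(ℝ). Then for every subset C' ⊆ C inducing a complete subgraph of G for which there exist vertices v₁ ∈ A and v₂ ∈ B each adjacent in G to every vertex of C', the map f[−] is Loewner super-additive on P_{|C'|}(ℝ), i.e., f[X+Y] − f[X] − f[Y] is positive semidefinite for all |C'|×|C'| real symmetric positive semidefinite matrices X, Y. -/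
open Matrix

/-- `P_G(I)`: symmetric positive semidefinite matrices with entries in `I`, vanishing at
off-diagonal positions corresponding to non-edges of `G`. -/
def PG {V : Type*} [Fintype V] (G : SimpleGraph V) (I : Set ℝ) : Set (Matrix V V ℝ) :=
  {M | M.PosSemidef ∧ (∀ i j, M i j ∈ I) ∧ ∀ i j, i ≠ j → ¬ G.Adj i j → M i j = 0}

/-- `H_G`: powers `α` such that `A ↦ A^{∘α}` maps `P_G([0,∞))` into `P_G(ℝ)`. -/
noncomputable def HSet {V : Type*} [Fintype V] (G : SimpleGraph V) : Set ℝ :=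
  {α | ∀ A ∈ PG G (Set.Ici 0), A.map (powF α) ∈ PG G Set.univ}

/-- `H_G^ψ`: powers `α` such that `ψ_α[-]` maps `P_G(ℝ)` into `P_G(ℝ)`. -/
noncomputable def HSetPsi {V : Type*} [Fintype V] (G : SimpleGraph V) : Set ℝ :=
  {α | ∀ A ∈ PG G Set.univ, A.map (psiF α) ∈ PG G Set.univ}

/-- `H_G^φ`: powers `α` such that `φ_α[-]` maps `P_G(ℝ)` into `P_G(ℝ)`. -/
noncomputable def HSetPhi {V : Type*} [Fintype V] (G : SimpleGraph V) : Set ℝ :=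
  {α | ∀ A ∈ PG G Set.univ, A.map (phiF α) ∈ PG G Set.univ}

/-- A graph is chordal if every cycle of length at least 4 has a chord, i.e. an edge of `G`
joining two vertices of the cycle that is not an edge of the cycle. -/
def IsChordalG {V : Type*} (G : SimpleGraph V) : Prop :=
  ∀ ⦃v : V⦄ (w : G.Walk v v), w.IsCycle → 4 ≤ w.length →
    ∃ i j : V, i ∈ w.support ∧ j ∈ w.support ∧ G.Adj i j ∧ ¬ w.toSubgraph.Adj i j
/-- `K_r^{(1)}` (the complete graph on `r` vertices minus one edge) is a subgraph of `G`:
there are `r` distinct vertices, all pairs of which are adjacent except possibly one fixed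
pair. -/
def HasKr1 {V : Type*} (G : SimpleGraph V) (r : ℕ) : Prop :=
  ∃ f : Fin r → V, Function.Injective f ∧ ∃ a b : Fin r,
    ∀ i j : Fin r, i ≠ j → ¬(i = a ∧ j = b) → ¬(i = b ∧ j = a) → G.Adj (f i) (f j)

/-- `(A, C, B)` is a decomposition of `G`: the three sets partition the vertex set, `C`
induces a complete subgraph, and `C` separates `A` from `B` (every walk from a vertex of
`A` to a vertex of `B` meets `C`). -/
def IsDecompositionG {n : ℕ} (G : SimpleGraph (Fin n)) (A C B : Finset (Fin n)) : Prop :=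
  (∀ v, v ∈ A ∨ v ∈ C ∨ v ∈ B) ∧ Disjoint A C ∧ Disjoint A B ∧ Disjoint C B ∧
    G.IsClique (C : Set (Fin n)) ∧
    ∀ a ∈ A, ∀ b ∈ B, ∀ p : G.Walk a b, ∃ c ∈ C, c ∈ p.support


/-- The two families at once. -/
noncomputable def famF (s : Bool) (a x : ℝ) : ℝ := if s then psiF a x else phiF a x

lemma famF_true (a : ℝ) : famF true a = psiF a := by funext x; simp [famF]
lemma famF_false (a : ℝ) : famF false a = phiF a := by funext x; simp [famF]

lemma famF_zero (s : Bool) (a : ℝ) : famF s a 0 = 0 := by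
  cases s <;> simp [famF, psiF, phiF]

lemma famF_pos (s : Bool) (a : ℝ) {x : ℝ} (hx : 0 < x) : famF s a x = x ^ a := by
  cases s <;> simp [famF, psiF, phiF, hx.ne', abs_of_pos hx, Real.sign_of_pos hx]

lemma famF_neg (s : Bool) (a : ℝ) {x : ℝ} (hx : x < 0) :
    famF s a x = (if s then -1 else 1) * (-x) ^ a := by
  cases s <;> simp [famF, psiF, phiF, hx.ne, abs_of_neg hx, Real.sign_of_neg hx]

lemma famF_mul (s : Bool) (a x y : ℝ) : famF s a (x * y) = famF s a x * famF s a y := by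
  rcases lt_trichotomy x 0 with hx | hx | hx
  · rcases lt_trichotomy y 0 with hy | hy | hy
    · rw [famF_pos s a (mul_pos_of_neg_of_neg hx hy), famF_neg s a hx, famF_neg s a hy,
        ← neg_mul_neg, Real.mul_rpow (by linarith) (by linarith)]
      cases s <;> simp
    · simp [hy, famF_zero]
    · rw [famF_neg s a (mul_neg_of_neg_of_pos hx hy), famF_neg s a hx, famF_pos s a hy,
        ← neg_mul, Real.mul_rpow (by linarith) (by linarith)]
      ring
  · simp [hx, famF_zero]
  · rcases lt_trichotomy y 0 with hy | hy | hy
    · rw [famF_neg s a (mul_neg_of_pos_of_neg hx hy), famF_pos s a hx, famF_neg s a hy,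
        ← mul_neg, Real.mul_rpow (by linarith) (by linarith)]
      ring
    · simp [hy, famF_zero]
    · rw [famF_pos s a (mul_pos hx hy), famF_pos s a hx, famF_pos s a hy,
        Real.mul_rpow hx.le hy.le]

lemma famF_one (s : Bool) (a : ℝ) : famF s a 1 = 1 := by
  rw [famF_pos s a one_pos, Real.one_rpow]

lemma famF_nonneg (s : Bool) (a : ℝ) {x : ℝ} (hx : 0 ≤ x) : 0 ≤ famF s a x := by
  rcases hx.eq_or_lt with h | h
  · rw [← h, famF_zero]
  · rw [famF_pos s a h]; positivity

lemma famF_mono (s : Bool) {a : ℝ} (ha : 0 < a) {x y : ℝ} (hx : 0 ≤ x) (hxy : x ≤ y) :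
    famF s a x ≤ famF s a y := by
  rcases hx.eq_or_lt with h | h
  · rw [← h, famF_zero]; exact famF_nonneg s a (by linarith)
  · rw [famF_pos s a h, famF_pos s a (by linarith)]
    exact Real.rpow_le_rpow hx hxy ha.le

lemma abs_famF (s : Bool) {a : ℝ} (ha : 0 < a) (x : ℝ) : |famF s a x| = |x| ^ a := by
  rcases lt_trichotomy x 0 with hx | hx | hx
  · rw [famF_neg s a hx, abs_of_neg hx, abs_mul, abs_of_nonneg (Real.rpow_nonneg (by linarith) a)]
    cases s <;> simp
  · simp [hx, famF_zero, Real.zero_rpow ha.ne']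
  · rw [famF_pos s a hx, abs_of_pos hx, abs_of_nonneg (Real.rpow_nonneg hx.le a)]

lemma famF_hasDerivAt (s : Bool) {a : ℝ} (ha : 1 < a) (x : ℝ) :
    HasDerivAt (famF s a) (a * famF (!s) (a - 1) x) x := by
  rcases lt_trichotomy x 0 with hx | hx | hx
  · have h1 : HasDerivAt (fun y : ℝ => (if s then -1 else 1) * (-y) ^ a)
        (a * famF (!s) (a - 1) x) x := by
      have := (((hasDerivAt_id x).neg).rpow_const (p := a) (Or.inr ha.le)).const_mul
        (if s then (-1:ℝ) else 1)
      refine this.congr_deriv ?_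
      rw [famF_neg _ _ hx]
      cases s <;> simp
    refine h1.congr_of_eventuallyEq ?_
    filter_upwards [Iio_mem_nhds hx] with y hy
    exact famF_neg s a hy
  · subst hx
    rw [famF_zero, mul_zero, hasDerivAt_iff_isLittleO]
    simp only [famF_zero, sub_zero, smul_zero]
    have h0 : HasDerivAt (fun x : ℝ => |x| ^ a) (0:ℝ) 0 := by
      simpa using hasDerivAt_abs_rpow 0 ha
    rw [hasDerivAt_iff_isLittleO] at h0
    simp only [abs_zero, Real.zero_rpow (by linarith : a ≠ 0), sub_zero, smul_zero] at h0
    refine Asymptotics.IsBigO.trans_isLittleO ?_ h0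
    refine Asymptotics.IsBigO.of_bound 1 (Filter.Eventually.of_forall fun y => ?_)
    rw [Real.norm_eq_abs, abs_famF s (by linarith), Real.norm_eq_abs, one_mul]
    exact le_abs_self _
  · have h1 : HasDerivAt (fun y : ℝ => y ^ a) (a * famF (!s) (a - 1) x) x := by
      rw [famF_pos _ _ hx]
      exact Real.hasDerivAt_rpow_const (Or.inr ha.le)
    refine h1.congr_of_eventuallyEq ?_
    filter_upwards [Ioi_mem_nhds hx] with y hy
    exact famF_pos s a hy

lemma famF_continuous_exp (s : Bool) (x : ℝ) : Continuous (fun a => famF s a x) := by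
  rcases lt_trichotomy x 0 with hx | hx | hx
  · simp only [famF_neg s _ hx]
    exact continuous_const.mul (Real.continuous_const_rpow (by linarith))
  · simp only [hx, famF_zero]; exact continuous_const
  · simp only [famF_pos s _ hx]
    exact Real.continuous_const_rpow (by linarith)

lemma psd_iff_s10 {ι : Type*} [Fintype ι] (M : Matrix ι ι ℝ) :
    M.PosSemidef ↔ (∀ i j, M i j = M j i) ∧ ∀ y : ι → ℝ, 0 ≤ ∑ i, ∑ j, y i * y j * M i j := by
  rw [Matrix.posSemidef_iff_dotProduct_mulVec]
  refine and_congr ⟨fun h i j => ?_, fun h => ?_⟩ (forall_congr' fun y => ?_)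
  · have := congrFun (congrFun h j) i
    simpa using this
  · ext i j; simpa using h j i
  · have : star y ⬝ᵥ (M *ᵥ y) = ∑ i, ∑ j, y i * y j * M i j := by
      simp only [dotProduct, mulVec, Finset.mul_sum]
      refine Finset.sum_congr rfl fun i _ => Finset.sum_congr rfl fun j _ => ?_
      simp; ring
    rw [this]

lemma psd_sym {ι : Type*} [Fintype ι] {M : Matrix ι ι ℝ} (h : M.PosSemidef) (i j : ι) :
    M i j = M j i := ((psd_iff_s10 M).1 h).1 i j

lemma psd_quad {ι : Type*} [Fintype ι] {M : Matrix ι ι ℝ} (h : M.PosSemidef) (y : ι → ℝ) :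
    0 ≤ ∑ i, ∑ j, y i * y j * M i j := ((psd_iff_s10 M).1 h).2 y

/-- Quadratic form along a segment is monotone if the derivative is nonnegative. -/
lemma quad_mono {ι : Type*} [Fintype ι] (g g' : ι → ι → ℝ → ℝ) (y : ι → ℝ)
    (hd : ∀ i j t, HasDerivAt (g i j) (g' i j t) t)
    (hn : ∀ t, 0 ≤ t → t ≤ 1 → 0 ≤ ∑ i, ∑ j, y i * y j * g' i j t) :
    ∑ i, ∑ j, y i * y j * g i j 0 ≤ ∑ i, ∑ j, y i * y j * g i j 1 := by
  have hD : ∀ t, HasDerivAt (fun t => ∑ i, ∑ j, y i * y j * g i j t)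
      (∑ i, ∑ j, y i * y j * g' i j t) t := fun t =>
    HasDerivAt.fun_sum fun i _ => HasDerivAt.fun_sum fun j _ => (hd i j t).const_mul _
  have hm : MonotoneOn (fun t => ∑ i, ∑ j, y i * y j * g i j t) (Set.Icc 0 1) := by
    refine monotoneOn_of_deriv_nonneg (convex_Icc 0 1)
      (fun t _ => (hD t).continuousAt.continuousWithinAt)
      (fun t _ => (hD t).differentiableAt.differentiableWithinAt) fun t ht => ?_
    rw [interior_Icc] at ht
    rw [(hD t).deriv]
    exact hn t ht.1.le ht.2.le
  exact hm (by simp) (by simp) zero_le_one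

lemma famF_line (s : Bool) {a : ℝ} (ha : 1 < a) (b r t : ℝ) :
    HasDerivAt (fun t => famF s a (b + t * r)) (a * (r * famF (!s) (a - 1) (b + t * r))) t := by
  have h1 : HasDerivAt (fun t : ℝ => b + t * r) r t := by
    simpa using ((hasDerivAt_id t).mul_const r).const_add b
  have := (famF_hasDerivAt s ha (b + t * r)).comp t h1
  refine this.congr_deriv ?_
  ring

/-- The Schur complement with respect to the zeroth index. -/
lemma schur_zero {n : ℕ} (A : Matrix (Fin (n + 1)) (Fin (n + 1)) ℝ) (hA : A.PosSemidef) :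
    (Matrix.of fun i j => A i j - A i 0 * A 0 j / A 0 0).PosSemidef ∧
      ∀ j, A 0 j - A 0 0 * A 0 j / A 0 0 = 0 := by
  have hsym := psd_sym hA
  have hexp : ∀ (x : Fin (n + 1) → ℝ) (r : ℝ),
      0 ≤ (∑ i, ∑ j, x i * x j * A i j) + 2 * r * (∑ i, x i * A i 0) + r ^ 2 * A 0 0 := by
    intro x r
    have h := psd_quad hA (fun i => x i + if i = 0 then r else 0)
    have : ∀ i j, (x i + if i = 0 then r else 0) * (x j + if j = 0 then r else 0) * A i j
        = x i * x j * A i j + (if j = 0 then r * (x i * A i j) else 0)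
          + (if i = 0 then r * (x j * A i j) else 0)
          + (if i = 0 then (if j = 0 then r ^ 2 * A i j else 0) else 0) := by
      intro i j
      split_ifs <;> ring
    simp only [this, Finset.sum_add_distrib, Finset.sum_ite_eq', Finset.mem_univ, if_true] at h
    have e : ∑ i, ∑ j, (if i = 0 then r * (x j * A i j) else 0) = r * ∑ i, x i * A i 0 := by
      rw [Finset.sum_comm]
      simp only [Finset.sum_ite_eq', Finset.mem_univ, if_true, Finset.mul_sum]
      exact Finset.sum_congr rfl fun i _ => by rw [hsym 0 i]
    have e2 : ∑ i, ∑ j, (if i = 0 then (if j = 0 then r ^ 2 * A i j else 0) else 0)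
        = r ^ 2 * A 0 0 := by
      rw [Finset.sum_comm]
      simp
    rw [e, e2, ← Finset.mul_sum] at h
    linarith
  have hc : 0 ≤ A 0 0 := by
    have := hexp 0 1
    simpa using this
  refine ⟨(psd_iff_s10 _).2 ⟨fun i j => ?_, fun x => ?_⟩, fun j => ?_⟩
  · simp only [Matrix.of_apply]
    rw [hsym i j, hsym i 0, hsym 0 j]; ring
  · simp only [Matrix.of_apply]
    have e : ∑ i, ∑ j, x i * x j * (A i j - A i 0 * A 0 j / A 0 0)
        = (∑ i, ∑ j, x i * x j * A i j) - (∑ i, x i * A i 0) ^ 2 / A 0 0 := by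
      rw [sq, Finset.sum_mul_sum, Finset.sum_div, ← Finset.sum_sub_distrib]
      refine Finset.sum_congr rfl fun i _ => ?_
      rw [Finset.sum_div, ← Finset.sum_sub_distrib]
      refine Finset.sum_congr rfl fun j _ => ?_
      rw [hsym 0 j]; ring
    rw [e]
    rcases hc.eq_or_lt with h | h
    · rw [← h]; simpa using psd_quad hA x
    · have := hexp x (-(∑ i, x i * A i 0) / A 0 0)
      have e3 : 2 * (-(∑ i, x i * A i 0) / A 0 0) * (∑ i, x i * A i 0)
          + (-(∑ i, x i * A i 0) / A 0 0) ^ 2 * A 0 0 = - ((∑ i, x i * A i 0) ^ 2 / A 0 0) := by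
        field_simp; ring
      linarith
  · rcases hc.eq_or_lt with h | h
    · rw [← h]
      have h2 : A j 0 = 0 := by
        by_contra hne
        have := hexp (Pi.single j 1) (-(A j j + 1) / (2 * A j 0))
        simp [Pi.single_apply, ← h] at this
        field_simp at this
        linarith
      rw [hsym 0 j, h2]; simp
    · field_simp; ring

lemma pos_base (s : Bool) {b : ℝ} (hb : 0 < b) (A : Matrix (Fin 2) (Fin 2) ℝ)
    (hA : A.PosSemidef) : (A.map (famF s b)).PosSemidef := by
  have hsym := psd_sym hA
  refine (psd_iff_s10 _).2 ⟨fun i j => by simp only [Matrix.map_apply]; rw [hsym], fun y => ?_⟩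
  have hq : ∀ u v : ℝ, 0 ≤ u ^ 2 * A 0 0 + 2 * u * v * A 0 1 + v ^ 2 * A 1 1 := by
    intro u v
    have := psd_quad hA ![u, v]
    simp [Fin.sum_univ_two] at this
    rw [hsym 1 0] at this
    linarith
  have h0 : 0 ≤ A 0 0 := by simpa using hq 1 0
  have h1 : 0 ≤ A 1 1 := by simpa using hq 0 1
  have hdet : A 0 1 * A 0 1 ≤ A 0 0 * A 1 1 := by
    have hd := discrim_le_zero (a := A 0 0) (b := 2 * A 0 1) (c := A 1 1) (fun u => by
      have := hq u 1; linarith)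
    unfold discrim at hd
    linarith
  have hf := famF_mono s hb (mul_self_nonneg (A 0 1)) hdet
  rw [famF_mul, famF_mul] at hf
  have hf0 := famF_nonneg s b h0
  have hf1 := famF_nonneg s b h1
  simp only [Fin.sum_univ_two, Matrix.map_apply]
  rw [hsym 1 0]
  set p := famF s b (A 0 0)
  set q := famF s b (A 0 1)
  set r := famF s b (A 1 1)
  rcases hf0.eq_or_lt with h | h
  · have hq0 : q = 0 := by
      rw [← h, zero_mul] at hf
      nlinarith
    rw [hq0, ← h]
    nlinarith [mul_nonneg (sq_nonneg (y 1)) hf1]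
  · have : 0 ≤ p * (y 0 * y 0 * p + y 0 * y 1 * q + (y 1 * y 0 * q + y 1 * y 1 * r)) := by
      nlinarith [sq_nonneg (p * y 0 + q * y 1), mul_nonneg (sq_nonneg (y 1)) (sub_nonneg.2 hf)]
    exact nonneg_of_mul_nonneg_right this h

lemma pos_all (k : ℕ) : ∀ (s : Bool) (b : ℝ), (k : ℝ) < b →
    ∀ A : Matrix (Fin (k + 2)) (Fin (k + 2)) ℝ, A.PosSemidef → (A.map (famF s b)).PosSemidef := by
  induction k with
  | zero => intro s b hb A hA; exact pos_base s (by simpa using hb) A hA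
  | succ k ih =>
    intro s b hb A hA
    push_cast at hb
    have hk : (0:ℝ) ≤ k := Nat.cast_nonneg k
    have hsym := psd_sym hA
    obtain ⟨hR, hR0⟩ := schur_zero A hA
    set R : Matrix (Fin (k + 3)) (Fin (k + 3)) ℝ :=
      Matrix.of fun i j => A i j - A i 0 * A 0 j / A 0 0 with hRdef
    have hRz : ∀ j, R 0 j = 0 := hR0
    have hRz' : ∀ j, R j 0 = 0 := fun j => by rw [psd_sym hR]; exact hRz j
    have hc : 0 ≤ A 0 0 := by
      have := psd_quad hA (Pi.single 0 1)
      simpa [Pi.single_apply] using this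
    set B : Matrix (Fin (k + 3)) (Fin (k + 3)) ℝ :=
      Matrix.of fun i j => A i 0 * A 0 j / A 0 0 with hBdef
    have hB : B.PosSemidef := by
      refine (psd_iff_s10 _).2 ⟨fun i j => ?_, fun y => ?_⟩
      · simp only [hBdef, Matrix.of_apply]; rw [hsym i 0, hsym 0 j]; ring
      · have : ∑ i, ∑ j, y i * y j * B i j = (∑ i, y i * A i 0) ^ 2 / A 0 0 := by
          rw [sq, Finset.sum_mul_sum, Finset.sum_div]
          refine Finset.sum_congr rfl fun i _ => ?_
          rw [Finset.sum_div]
          refine Finset.sum_congr rfl fun j _ => ?_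
          simp only [hBdef, Matrix.of_apply]
          rw [hsym 0 j]; ring
        rw [this]; positivity
    have hAB : ∀ i j, B i j + R i j = A i j := by
      intro i j; simp [hBdef, hRdef]
    refine (psd_iff_s10 _).2 ⟨fun i j => by simp only [Matrix.map_apply]; rw [hsym], fun y => ?_⟩
    have key := quad_mono (fun i j t => famF s b (B i j + t * R i j))
      (fun i j t => b * (R i j * famF (!s) (b - 1) (B i j + t * R i j))) y
      (fun i j t => famF_line s (by linarith) _ _ _) (fun t ht0 ht1 => by
        have hP : (B + t • R).PosSemidef := hB.add (hR.smul ht0)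
        have h1 := ih (!s) (b - 1) (by linarith) _ (hP.submatrix Fin.succ)
        have h2 := (hR.submatrix Fin.succ).hadamard h1
        have h3 := psd_quad h2 (fun i => y i.succ)
        have e : ∑ i, ∑ j, y i * y j * (b * (R i j * famF (!s) (b - 1) (B i j + t * R i j)))
            = b * ∑ i : Fin (k + 2), ∑ j : Fin (k + 2), y i.succ * y j.succ *
              (R i.succ j.succ * famF (!s) (b - 1)
                (B i.succ j.succ + t * R i.succ j.succ)) := by
          rw [Fin.sum_univ_succ]
          simp only [hRz, zero_mul, mul_zero, Finset.sum_const_zero, zero_add, Finset.mul_sum]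
          refine Finset.sum_congr rfl fun i _ => ?_
          rw [Fin.sum_univ_succ]
          simp only [hRz', zero_mul, mul_zero, zero_add]
          refine Finset.sum_congr rfl fun j _ => ?_
          ring
        rw [e]
        refine mul_nonneg (by linarith) ?_
        simpa using h3)
    simp only [zero_mul, add_zero, one_mul, hAB] at key
    simp only [Matrix.map_apply]
    refine le_trans ?_ key
    have : ∑ i, ∑ j, y i * y j * famF s b (B i j)
        = (∑ i, y i * famF s b (A i 0)) ^ 2 * famF s b (A 0 0)⁻¹ := by
      rw [sq, Finset.sum_mul_sum, Finset.sum_mul]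
      refine Finset.sum_congr rfl fun i _ => ?_
      rw [Finset.sum_mul]
      refine Finset.sum_congr rfl fun j _ => ?_
      simp only [hBdef, Matrix.of_apply]
      rw [hsym 0 j, div_eq_mul_inv, famF_mul, famF_mul]; ring
    rw [this]
    exact mul_nonneg (sq_nonneg _) (famF_nonneg _ _ (inv_nonneg.2 hc))

lemma mono_all (k : ℕ) (s : Bool) (b : ℝ) (hb : (k : ℝ) + 1 < b)
    (X Y : Matrix (Fin (k + 2)) (Fin (k + 2)) ℝ) (hX : X.PosSemidef) (hY : Y.PosSemidef) :
    ((X + Y).map (famF s b) - X.map (famF s b)).PosSemidef := by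
  have hk : (0:ℝ) ≤ k := Nat.cast_nonneg k
  refine (psd_iff_s10 _).2 ⟨fun i j => ?_, fun y => ?_⟩
  · simp only [Matrix.sub_apply, Matrix.map_apply, Matrix.add_apply]
    rw [psd_sym hX, psd_sym hY]
  have key := quad_mono (fun i j t => famF s b (X i j + t * Y i j))
      (fun i j t => b * (Y i j * famF (!s) (b - 1) (X i j + t * Y i j))) y
      (fun i j t => famF_line s (by linarith) _ _ _) (fun t ht0 ht1 => by
        have hP : (X + t • Y).PosSemidef := hX.add (hY.smul ht0)
        have h1 := pos_all k (!s) (b - 1) (by linarith) _ hP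
        have h3 := psd_quad ((hY.hadamard h1).smul (by linarith : 0 ≤ b)) y
        simpa using h3)
  simp only [zero_mul, add_zero, one_mul] at key
  simp only [Matrix.sub_apply, Matrix.map_apply, Matrix.add_apply, mul_sub,
    Finset.sum_sub_distrib]
  linarith

lemma super_lt (k : ℕ) (s : Bool) (b : ℝ) (hb : (k : ℝ) + 2 < b)
    (X Y : Matrix (Fin (k + 2)) (Fin (k + 2)) ℝ) (hX : X.PosSemidef) (hY : Y.PosSemidef)
    (y : Fin (k + 2) → ℝ) :
    0 ≤ ∑ i, ∑ j, y i * y j * (famF s b (X i j + Y i j) - famF s b (X i j) - famF s b (Y i j)) := by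
  have hk : (0:ℝ) ≤ k := Nat.cast_nonneg k
  have key := quad_mono (fun i j t => famF s b (X i j + t * Y i j) - famF s b (0 + t * Y i j))
      (fun i j t => b * (Y i j * famF (!s) (b - 1) (X i j + t * Y i j))
        - b * (Y i j * famF (!s) (b - 1) (0 + t * Y i j))) y
      (fun i j t => (famF_line s (by linarith) _ _ _).sub (famF_line s (by linarith) _ _ _))
      (fun t ht0 ht1 => by
        have h1 := mono_all k (!s) (b - 1) (by linarith) _ _ (hY.smul ht0) hX
        have h3 := psd_quad ((hY.hadamard h1).smul (by linarith : 0 ≤ b)) y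
        refine h3.trans (le_of_eq ?_)
        refine Finset.sum_congr rfl fun i _ => Finset.sum_congr rfl fun j _ => ?_
        simp only [Matrix.smul_apply, Matrix.hadamard_apply, Matrix.sub_apply, Matrix.map_apply,
          Matrix.add_apply, smul_eq_mul, zero_add]
        rw [add_comm (t * Y i j)]
        ring)
  simp only [zero_mul, add_zero, one_mul, famF_zero, sub_zero, zero_add] at key
  simp only [mul_sub, Finset.sum_sub_distrib] at key ⊢
  linarith

lemma super_le (k : ℕ) (s : Bool) (b : ℝ) (hb : (k : ℝ) + 2 ≤ b)
    (X Y : Matrix (Fin (k + 2)) (Fin (k + 2)) ℝ) (hX : X.PosSemidef) (hY : Y.PosSemidef) :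
    ((X + Y).map (famF s b) - X.map (famF s b) - Y.map (famF s b)).PosSemidef := by
  refine (psd_iff_s10 _).2 ⟨fun i j => ?_, fun y => ?_⟩
  · simp only [Matrix.sub_apply, Matrix.map_apply, Matrix.add_apply]
    rw [psd_sym hX, psd_sym hY]
  simp only [Matrix.sub_apply, Matrix.map_apply, Matrix.add_apply]
  have hcont : Continuous (fun a => ∑ i, ∑ j, y i * y j *
      (famF s a (X i j + Y i j) - famF s a (X i j) - famF s a (Y i j))) := by
    refine continuous_finsetSum _ fun i _ => continuous_finsetSum _ fun j _ => ?_
    exact continuous_const.mul (((famF_continuous_exp s _).sub (famF_continuous_exp s _)).sub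
      (famF_continuous_exp s _))
  have hlim := (hcont.tendsto b).mono_left (nhdsWithin_le_nhds (s := Set.Ioi b))
  refine ge_of_tendsto hlim ?_
  filter_upwards [self_mem_nhdsWithin] with a ha
  exact super_lt k s a (lt_of_le_of_lt hb ha) X Y hX hY y

lemma super_one (s : Bool) (b : ℝ) (hb : 1 ≤ b)
    (X Y : Matrix (Fin 1) (Fin 1) ℝ) (hX : X.PosSemidef) (hY : Y.PosSemidef) :
    ((X + Y).map (famF s b) - X.map (famF s b) - Y.map (famF s b)).PosSemidef := by
  have hx : 0 ≤ X 0 0 := by simpa using psd_quad hX 1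
  have hy : 0 ≤ Y 0 0 := by simpa using psd_quad hY 1
  have key : famF s b (X 0 0) + famF s b (Y 0 0) ≤ famF s b (X 0 0 + Y 0 0) := by
    rcases hx.eq_or_lt with h | h
    · simp [← h, famF_zero]
    rcases hy.eq_or_lt with h' | h'
    · simp [← h', famF_zero]
    rw [famF_pos s b h, famF_pos s b h', famF_pos s b (by linarith)]
    exact Real.add_rpow_le_rpow_add hx hy hb
  refine (psd_iff_s10 _).2 ⟨fun i j => ?_, fun y => ?_⟩
  · rw [Subsingleton.elim i j]
  · simp only [Finset.univ_unique, Fin.default_eq_zero, Finset.sum_singleton, Matrix.sub_apply,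
      Matrix.map_apply, Matrix.add_apply, Fin.isValue]
    exact mul_nonneg (mul_self_nonneg _) (by linarith)

lemma psd_had {m : ℕ} {X Y : Matrix (Fin m) (Fin m) ℝ} (hX : X.PosSemidef)
    (hY : Y.PosSemidef) : (Matrix.of fun i j => X i j * Y i j).PosSemidef :=
  hX.hadamard hY

lemma super_pow (m k : ℕ) (f : ℝ → ℝ) (hf : ∀ x, f x = x ^ (k + 1))
    (X Y : Matrix (Fin m) (Fin m) ℝ) (hX : X.PosSemidef) (hY : Y.PosSemidef) :
    ((X + Y).map f - X.map f - Y.map f).PosSemidef := by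
  obtain rfl : f = fun x => x ^ (k + 1) := funext hf
  clear hf
  have hp : ∀ (Z : Matrix (Fin m) (Fin m) ℝ), Z.PosSemidef → ∀ k : ℕ,
      (Z.map (fun x => x ^ (k + 1))).PosSemidef := by
    intro Z hZ k
    induction k with
    | zero => simpa using hZ
    | succ k ih =>
      convert psd_had hZ ih using 1
      ext i j; simp; ring
  induction k with
  | zero =>
    convert Matrix.PosSemidef.zero (n := Fin m) (R := ℝ) using 1
    ext i j; simp
  | succ k ih =>
    convert ((psd_had (hX.add hY) ih).add (psd_had hX (hp Y hY k))).add
      (psd_had hY (hp X hX k)) using 1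
    ext i j; simp; ring

lemma poly_mult (f : ℝ → ℝ) (hm : ∀ x y, f (x * y) = f x * f y) (h0 : f 0 = 0) (h1 : f 1 = 1)
    (p : Polynomial ℝ) (hp : ∀ t, f t = p.eval t) : ∃ k : ℕ, ∀ x, f x = x ^ (k + 1) := by
  have hp0 : p ≠ 0 := by
    rintro rfl
    have := hp 1
    rw [h1] at this
    simp at this
  have hpow : ∀ c, f c = c ^ p.natDegree := by
    intro c
    have e : p.comp (Polynomial.C c * Polynomial.X) = Polynomial.C (f c) * p := by
      refine Polynomial.funext fun r => ?_
      simp [Polynomial.eval_comp, ← hp, hm]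
    have e2 := congrArg (fun q => Polynomial.coeff q p.natDegree) e
    simp only [Polynomial.comp_C_mul_X_coeff, Polynomial.coeff_C_mul] at e2
    have hl : p.coeff p.natDegree ≠ 0 := by simpa using hp0
    rw [mul_comm] at e2
    exact (mul_right_cancel₀ hl e2).symm
  have hd : p.natDegree ≠ 0 := by
    intro h
    have := hpow 0
    rw [h0, h] at this
    simp at this
  obtain ⟨k, hk⟩ := Nat.exists_eq_succ_of_ne_zero hd
  exact ⟨k, fun x => by rw [hpow, hk]⟩

lemma poly_or_vec (f : ℝ → ℝ) (h0 : f 0 = 0) (K m : ℕ) (hK : K < m) :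
    (∃ x y : Fin m → ℝ, (∀ k, k < K → ∑ i, y i * x i ^ (k + 1) = 0) ∧ ∑ i, y i * f (x i) ≠ 0) ∨
      ∃ p : Polynomial ℝ, ∀ t, f t = p.eval t := by
  by_cases hvec : ∃ x y : Fin m → ℝ,
      (∀ k, k < K → ∑ i, y i * x i ^ (k + 1) = 0) ∧ ∑ i, y i * f (x i) ≠ 0
  · exact Or.inl hvec
  right
  have hspan : ∀ x : Fin m → ℝ, ∃ a : Fin K → ℝ, ∀ i, ∑ k, a k * x i ^ ((k : ℕ) + 1) = f (x i) := by
    intro x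
    have hmem : (fun i => f (x i)) ∈ Submodule.span ℝ
        (Set.range fun (k : Fin K) => fun i => x i ^ ((k : ℕ) + 1)) := by
      by_contra hn
      obtain ⟨φ, hφ, hφ0⟩ := Submodule.exists_dual_map_eq_bot_of_notMem hn inferInstance
      have hrep : ∀ w : Fin m → ℝ, φ w = ∑ i, φ (Pi.single i 1) * w i := by
        intro w
        conv_lhs => rw [pi_eq_sum_univ' w]
        rw [map_sum]
        refine Finset.sum_congr rfl fun i _ => ?_
        rw [map_smul, smul_eq_mul, mul_comm]
      refine hvec ⟨x, fun i => φ (Pi.single i 1), fun k hk => ?_, ?_⟩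
      · rw [← hrep fun i => x i ^ (k + 1)]
        have : φ (fun i => x i ^ (k + 1)) ∈ Submodule.map φ (Submodule.span ℝ
            (Set.range fun (k : Fin K) => fun i => x i ^ ((k : ℕ) + 1))) :=
          Submodule.mem_map_of_mem (Submodule.subset_span ⟨⟨k, hk⟩, rfl⟩)
        rw [hφ0] at this
        simpa using this
      · rw [← hrep fun i => f (x i)]
        exact hφ
    obtain ⟨a, ha⟩ := (Submodule.mem_span_range_iff_exists_fun ℝ).1 hmem
    refine ⟨a, fun i => ?_⟩
    have := congrFun ha i
    simpa using this
  have hpt : ∀ t : ℝ, ∃ p : Polynomial ℝ, p.degree < ((Finset.range (K + 1)).card : ℕ) ∧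
      (∀ i ∈ Finset.range (K + 1), p.eval (i : ℝ) = f i) ∧ p.eval t = f t := by
    intro t
    obtain ⟨a, ha⟩ := hspan (fun i => if (i : ℕ) < K then ((i : ℕ) : ℝ) + 1 else t)
    refine ⟨∑ k : Fin K, Polynomial.C (a k) * Polynomial.X ^ ((k : ℕ) + 1), ?_, ?_, ?_⟩
    · rw [Finset.card_range]
      refine (Polynomial.degree_sum_le _ _).trans_lt ?_
      rw [Finset.sup_lt_iff (by exact_mod_cast WithBot.bot_lt_coe _)]
      intro k _
      refine (Polynomial.degree_C_mul_X_pow_le _ _).trans_lt ?_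
      have := k.2
      exact_mod_cast (by omega : (k : ℕ) + 1 < K + 1)
    · intro i hi
      rw [Finset.mem_range] at hi
      rcases Nat.eq_zero_or_pos i with h | h
      · subst h
        simp [Polynomial.eval_finsetSum, h0]
      · have := ha ⟨i - 1, by omega⟩
        simp only [show i - 1 < K by omega, if_true] at this
        have e : ((i - 1 : ℕ) : ℝ) + 1 = i := by
          rw [Nat.cast_sub h]; simp
        rw [e] at this
        rw [← this]
        simp [Polynomial.eval_finsetSum]
    · have := ha ⟨K, hK⟩
      simp only [lt_irrefl, if_false] at this
      rw [← this]
      simp [Polynomial.eval_finsetSum]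
  choose p hp1 hp2 hp3 using hpt
  refine ⟨p 0, fun t => ?_⟩
  have : p 0 = p t := Polynomial.eq_of_degrees_lt_of_eval_index_eq (Finset.range (K + 1))
    (v := fun i : ℕ => (i : ℝ)) (fun i _ j _ h => Nat.cast_injective h) (hp1 0) (hp1 t)
    (fun i hi => by rw [hp2 0 i hi, hp2 t i hi])
  rw [this, hp3]

open Filter Topology in
lemma taylor_rpow (α : ℝ) (N : ℕ) : ∃ c : ℕ → ℝ, c 0 = 1 ∧
    (fun s : ℝ => (1 + s) ^ α - ∑ k ∈ Finset.range N, c k * s ^ k) =O[𝓝 0] fun s => ‖s‖ ^ N := by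
  have h := Real.one_add_rpow_hasFPowerSeriesAt_zero (a := α)
  refine ⟨fun k => (binomialSeries ℝ α).coeff k, ?_, ?_⟩
  · exact (h.coeff_zero 1).trans (by simp)
  · have h2 := h.isBigO_sub_partialSum_pow N
    refine h2.congr_left fun s => ?_
    simp only [zero_add, FormalMultilinearSeries.partialSum]
    congr 1
    refine Finset.sum_congr rfl fun k _ => ?_
    rw [FormalMultilinearSeries.apply_eq_pow_smul_coeff, smul_eq_mul, mul_comm]

open Filter Topology in
lemma no_vec (s : Bool) (α : ℝ) (m K : ℕ) (hα : α < K + 1)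
    (H : ∀ u v y : Fin m → ℝ, (∑ i, y i * famF s α (u i)) ^ 2 + (∑ i, y i * famF s α (v i)) ^ 2
      ≤ ∑ i, ∑ j, y i * y j * famF s α (u i * u j + v i * v j))
    (x y : Fin m → ℝ) (hxy : ∀ k, k < K → ∑ i, y i * x i ^ (k + 1) = 0) :
    ∑ i, y i * famF s α (x i) = 0 := by
  by_contra hne
  set d := ∑ i, y i * famF s α (x i) with hd
  obtain ⟨c, hc0, hO⟩ := taylor_rpow α (K + 1)
  set r : ℝ → ℝ := fun s : ℝ => (1 + s) ^ α - ∑ k ∈ Finset.range (K + 1), c k * s ^ k with hr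
  have hT : ∀ i j, Tendsto (fun e : ℝ => e * (x i * x j)) (𝓝[>] 0) (𝓝 0) := by
    intro i j
    have : Tendsto (fun e : ℝ => e * (x i * x j)) (𝓝 0) (𝓝 (0 * (x i * x j))) :=
      tendsto_id.mul_const _
    rw [zero_mul] at this
    exact this.mono_left nhdsWithin_le_nhds
  have hRO : (fun e : ℝ => ∑ i, ∑ j, y i * y j * r (e * (x i * x j))) =O[𝓝[>] 0]
      fun e : ℝ => e ^ (K + 1) := by
    refine Asymptotics.IsBigO.fun_sum fun i _ => Asymptotics.IsBigO.fun_sum fun j _ => ?_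
    refine Asymptotics.IsBigO.const_mul_left ?_ _
    refine (hO.comp_tendsto (hT i j)).trans ?_
    refine Asymptotics.IsBigO.of_bound (‖x i * x j‖ ^ (K + 1)) (Eventually.of_forall fun e => ?_)
    simp only [Function.comp, norm_mul, norm_pow, norm_norm, mul_pow]
    exact le_of_eq (by ring)
  obtain ⟨M, hM⟩ := hRO.bound
  have hev : ∀ᶠ e : ℝ in 𝓝[>] 0, ∀ i j, 0 < 1 + e * (x i * x j) := by
    rw [eventually_all]; intro i
    rw [eventually_all]; intro j
    filter_upwards [(hT i j).eventually (Ioi_mem_nhds (show (-1:ℝ) < 0 by norm_num))] with e he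
    have : -1 < e * (x i * x j) := he
    linarith
  have hfin : ∀ᶠ e : ℝ in 𝓝[>] 0, d ^ 2 ≤ M * e ^ ((K : ℝ) + 1 - α) := by
    filter_upwards [hM, hev, self_mem_nhdsWithin] with e h1 h2 h3
    have he : 0 < e := h3
    have hH := H (fun _ => 1) (fun i => √e * x i) y
    have e1 : ∑ i, y i * famF s α (√e * x i) = famF s α √e * d := by
      rw [hd, Finset.mul_sum]
      exact Finset.sum_congr rfl fun i _ => by rw [famF_mul]; ring
    have e2 : famF s α √e ^ 2 = e ^ α := by
      rw [sq, ← famF_mul, Real.mul_self_sqrt he.le, famF_pos s α he]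
    have e3 : ∀ i j, famF s α (1 * 1 + √e * x i * (√e * x j)) =
        r (e * (x i * x j)) + ∑ k ∈ Finset.range (K + 1), c k * (e * (x i * x j)) ^ k := by
      intro i j
      have : √e * x i * (√e * x j) = e * (x i * x j) := by
        rw [mul_mul_mul_comm, Real.mul_self_sqrt he.le]
      rw [this, one_mul, famF_pos s α (h2 i j), hr]
      ring
    have e4 : ∑ i, ∑ j, y i * y j * ∑ k ∈ Finset.range (K + 1), c k * (e * (x i * x j)) ^ k
        = (∑ i, y i) ^ 2 := by
      have : ∀ i j, y i * y j * ∑ k ∈ Finset.range (K + 1), c k * (e * (x i * x j)) ^ k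
          = ∑ k ∈ Finset.range (K + 1), c k * e ^ k * ((y i * x i ^ k) * (y j * x j ^ k)) := by
        intro i j
        rw [Finset.mul_sum]
        refine Finset.sum_congr rfl fun k _ => ?_
        rw [mul_pow, mul_pow]; ring
      simp only [this]
      have e5 : ∀ i, ∑ j, ∑ k ∈ Finset.range (K + 1),
          c k * e ^ k * ((y i * x i ^ k) * (y j * x j ^ k))
          = ∑ k ∈ Finset.range (K + 1), c k * e ^ k * ((y i * x i ^ k) * ∑ j, (y j * x j ^ k)) := by
        intro i
        rw [Finset.sum_comm]
        refine Finset.sum_congr rfl fun k _ => ?_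
        rw [Finset.mul_sum, Finset.mul_sum]
      simp only [e5]
      rw [Finset.sum_comm, Finset.sum_range_succ', Finset.sum_eq_zero]
      · simp [hc0, ← Finset.sum_mul, sq]
      · intro k hk
        rw [hxy k (Finset.mem_range.1 hk)]
        simp
    simp only [e1, e3, mul_add, Finset.sum_add_distrib, e4] at hH
    simp only [famF_one, mul_one, mul_pow, e2] at hH
    have h4 : e ^ α * d ^ 2 ≤ M * e ^ (K + 1) := by
      have h5 := (le_abs_self _).trans h1
      rw [Real.norm_eq_abs, abs_of_pos (pow_pos he _)] at h5
      linarith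
    rw [Real.rpow_sub he, ← mul_div_assoc, le_div_iff₀ (Real.rpow_pos_of_pos he α), mul_comm]
    have : e ^ ((K : ℝ) + 1) = e ^ (K + 1) := by
      rw [← Real.rpow_natCast]; push_cast; rfl
    rw [this]
    exact h4
  have hlim : Tendsto (fun e : ℝ => M * e ^ ((K : ℝ) + 1 - α)) (𝓝[>] 0) (𝓝 0) := by
    have hp : (0:ℝ) < (K : ℝ) + 1 - α := by linarith
    have := ((Real.continuousAt_rpow_const 0 _ (Or.inr hp.le)).tendsto.const_mul M).mono_left
      (nhdsWithin_le_nhds (s := Set.Ioi 0))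
    rw [Real.zero_rpow hp.ne', mul_zero] at this
    exact this
  have := ge_of_tendsto hlim hfin
  have h2 : 0 < d ^ 2 := by positivity
  linarith

lemma nec (s : Bool) (α : ℝ) (m : ℕ) (hm : 0 < m)
    (H : ∀ u v y : Fin m → ℝ, (∑ i, y i * famF s α (u i)) ^ 2 + (∑ i, y i * famF s α (v i)) ^ 2
      ≤ ∑ i, ∑ j, y i * y j * famF s α (u i * u j + v i * v j)) :
    (1 ≤ α ∧ (m : ℝ) ≤ α) ∨ ∃ k : ℕ, ∀ x, famF s α x = x ^ (k + 1) := by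
  have h1 : 1 ≤ α := by
    have := H (fun _ => 1) (fun _ => 1) (Pi.single ⟨0, hm⟩ 1)
    simp [Pi.single_apply, famF_one] at this
    rw [famF_pos s α (by norm_num)] at this
    by_contra hlt
    push Not at hlt
    have h2 := Real.rpow_lt_rpow_of_exponent_lt (show (1:ℝ) < 1 + 1 by norm_num) hlt
    rw [Real.rpow_one] at h2
    linarith
  by_cases hmα : (m : ℝ) ≤ α
  · exact Or.inl ⟨h1, hmα⟩
  right
  push Not at hmα
  have hK : ⌊α⌋₊ < m := (Nat.floor_lt (by linarith)).2 hmα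
  rcases poly_or_vec (famF s α) (famF_zero s α) _ m hK with ⟨x, y, hxy, hne⟩ | ⟨p, hp⟩
  · exact absurd (no_vec s α m _ (Nat.lt_floor_add_one α) H x y hxy) hne
  · exact poly_mult _ (famF_mul s α) (famF_zero s α) (famF_one s α) p hp

lemma rank_one (n : ℕ) (G : SimpleGraph (Fin n)) (f : ℝ → ℝ) (hf0 : f 0 = 0) (hf1 : f 1 = 1)
    (hpres : ∀ M ∈ PG G Set.univ, M.map f ∈ PG G Set.univ)
    (C' : Finset (Fin n)) (hC'clique : G.IsClique (C' : Set (Fin n)))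
    (v₁ v₂ : Fin n) (hne : v₁ ≠ v₂) (hv₁ : v₁ ∉ C') (hv₂ : v₂ ∉ C')
    (hadj₁ : ∀ c ∈ C', G.Adj v₁ c) (hadj₂ : ∀ c ∈ C', G.Adj v₂ c)
    (u v y : Fin C'.card → ℝ) :
    (∑ i, y i * f (u i)) ^ 2 + (∑ i, y i * f (v i)) ^ 2
      ≤ ∑ i, ∑ j, y i * y j * f (u i * u j + v i * v j) := by
  set ext : Fin n → (Fin C'.card → ℝ) → Fin n → ℝ := fun p q w =>
    if w = p then 1 else if h : w ∈ C' then q (C'.equivFin ⟨w, h⟩) else 0 with hext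
  have hsupp : ∀ p q, (∀ c ∈ C', G.Adj p c) → ∀ i j, i ≠ j → ¬ G.Adj i j →
      ext p q i * ext p q j = 0 := by
    intro p q hp i j hij hnadj
    simp only [hext]
    by_cases hi : i = p
    · by_cases hj : j ∈ C'
      · exact absurd (hi ▸ hp j hj) hnadj
      · have : j ≠ p := fun h => hij (hi.trans h.symm)
        simp [this, hj]
    · by_cases hi' : i ∈ C'
      · by_cases hj : j = p
        · exact absurd (hj ▸ (hp i hi').symm) hnadj
        · by_cases hj' : j ∈ C'
          · exact absurd (hC'clique hi' hj' hij) hnadj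
          · simp [hj, hj']
      · simp [hi, hi']
  set U := ext v₁ u with hU
  set W := ext v₂ v with hW
  have hM : (Matrix.of fun i j => U i * U j + W i * W j) ∈ PG G Set.univ := by
    refine ⟨(psd_iff_s10 _).2 ⟨fun i j => ?_, fun z => ?_⟩, fun _ _ => trivial, fun i j hij hn => ?_⟩
    · simp only [Matrix.of_apply]; ring
    · have : ∑ i, ∑ j, z i * z j * (Matrix.of fun i j => U i * U j + W i * W j) i j
          = (∑ i, z i * U i) ^ 2 + (∑ i, z i * W i) ^ 2 := by
        rw [sq, sq, Finset.sum_mul_sum, Finset.sum_mul_sum, ← Finset.sum_add_distrib]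
        refine Finset.sum_congr rfl fun i _ => ?_
        rw [← Finset.sum_add_distrib]
        refine Finset.sum_congr rfl fun j _ => ?_
        simp only [Matrix.of_apply]; ring
      rw [this]; positivity
    · simp only [Matrix.of_apply]
      rw [hU, hW, hsupp v₁ u hadj₁ i j hij hn, hsupp v₂ v hadj₂ i j hij hn, add_zero]
  have hfM := (hpres _ hM).1
  set g : Fin C'.card ⊕ Fin 2 → Fin n :=
    Sum.elim (fun i => (C'.equivFin.symm i : Fin n)) ![v₁, v₂] with hg
  have hmem : ∀ i, (C'.equivFin.symm i : Fin n) ∈ C' := fun i => (C'.equivFin.symm i).2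
  have hU1 : U v₁ = 1 := by simp [hU, hext]
  have hU2 : U v₂ = 0 := by simp [hU, hext, hne.symm, hv₂]
  have hW1 : W v₁ = 0 := by simp [hW, hext, hne, hv₁]
  have hW2 : W v₂ = 1 := by simp [hW, hext]
  have hUC : ∀ i, U (C'.equivFin.symm i) = u i := by
    intro i
    have h1 : (C'.equivFin.symm i : Fin n) ≠ v₁ := fun h => hv₁ (h ▸ hmem i)
    simp [hU, hext, h1]
  have hWC : ∀ i, W (C'.equivFin.symm i) = v i := by
    intro i
    have h1 : (C'.equivFin.symm i : Fin n) ≠ v₂ := fun h => hv₂ (h ▸ hmem i)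
    simp [hW, hext, h1]
  set a := ∑ i, y i * f (u i) with ha
  set b := ∑ i, y i * f (v i) with hb
  have key := psd_quad (hfM.submatrix g) (Sum.elim y ![-a, -b])
  simp only [Fintype.sum_sum_type, Fin.sum_univ_two, Matrix.submatrix_apply, Matrix.map_apply,
    Matrix.of_apply, hg, Sum.elim_inl, Sum.elim_inr, Matrix.cons_val_zero, Matrix.cons_val_one,
    hU1, hU2, hW1, hW2, hUC, hWC, mul_zero, zero_mul, mul_one, one_mul, add_zero, zero_add,
    hf0, hf1, Finset.sum_add_distrib] at key
  have t1 : ∑ i, y i * -a * f (u i) = -a * a := by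
    conv_rhs => rw [ha, ← ha, Finset.mul_sum]
    exact Finset.sum_congr rfl fun i _ => by ring
  have t2 : ∑ i, y i * -b * f (v i) = -b * b := by
    conv_rhs => rw [hb, ← hb, Finset.mul_sum]
    exact Finset.sum_congr rfl fun i _ => by ring
  have t3 : ∑ i, -a * y i * f (u i) = -a * a := by
    rw [← t1]; exact Finset.sum_congr rfl fun i _ => by ring
  have t4 : ∑ i, -b * y i * f (v i) = -b * b := by
    rw [← t2]; exact Finset.sum_congr rfl fun i _ => by ring
  rw [t1, t2, t3, t4] at key
  nlinarith [key]

/-- If `f = ψ_α` or `f = φ_α` preserves positivity on `P_G(ℝ)` for a graph `G` with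
decomposition `(A, C, B)`, then `f[-]` is Loewner super-additive on `P_{|C'|}(ℝ)` for every
clique `C' ⊆ C` admitting vertices `v₁ ∈ A`, `v₂ ∈ B` adjacent to every vertex of `C'`. -/
theorem stmt10 (n : ℕ) (G : SimpleGraph (Fin n)) (A C B : Finset (Fin n))
    (hdec : IsDecompositionG G A C B) (α : ℝ) (f : ℝ → ℝ)
    (hf : f = psiF α ∨ f = phiF α)
    (hpres : ∀ M ∈ PG G Set.univ, M.map f ∈ PG G Set.univ)
    (C' : Finset (Fin n)) (hC'sub : C' ⊆ C) (hC'clique : G.IsClique (C' : Set (Fin n)))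
    (v₁ v₂ : Fin n) (hv₁ : v₁ ∈ A) (hv₂ : v₂ ∈ B)
    (hadj₁ : ∀ c ∈ C', G.Adj v₁ c) (hadj₂ : ∀ c ∈ C', G.Adj v₂ c) :
    ∀ X Y : Matrix (Fin C'.card) (Fin C'.card) ℝ, X.PosSemidef → Y.PosSemidef →
      ((X + Y).map f - X.map f - Y.map f).PosSemidef := by
  have hs : ∃ s : Bool, f = famF s α := by
    rcases hf with h | h
    · exact ⟨true, by rw [h, famF_true]⟩
    · exact ⟨false, by rw [h, famF_false]⟩
  obtain ⟨s, rfl⟩ := hs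
  obtain ⟨-, hAC, hAB, hCB, -, -⟩ := hdec
  have H := rank_one n G _ (famF_zero s α) (famF_one s α) hpres C' hC'clique v₁ v₂
    (fun h => Finset.disjoint_left.1 hAB hv₁ (h ▸ hv₂))
    (fun h => Finset.disjoint_left.1 hAC hv₁ (hC'sub h))
    (fun h => Finset.disjoint_left.1 hCB (hC'sub h) hv₂) hadj₁ hadj₂
  generalize C'.card = m at H
  intro X Y hX hY
  rcases Nat.eq_zero_or_pos m with hm | hm
  · subst hm
    exact (psd_iff_s10 _).2 ⟨fun i => i.elim0, fun y => by simp⟩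
  rcases nec s α m hm H with ⟨h1, h2⟩ | ⟨k, hk⟩
  · match m, hm with
    | 1, _ => exact super_one s α h1 X Y hX hY
    | k + 2, _ => exact super_le k s α (by push_cast at h2; linarith) X Y hX hY
  · exact super_pow m k _ hk X Y hX hY
end
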